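/- arXiv:1508.07512 — 2 statements merged into one kernel-verified Lean document; each statement's English description precedes it below -/
import Mathlib

section
/- For every x ∈ X with x_k > 0 for all k ∈ K, one has Ξ(x) ≤ 0, and Ξ(x) = 0 if and only if x = x^{*,a}, the unique minimizer of L^{(a)} over X. -/
open scoped BigOperators
open Filter Topology

noncomputable section

variable {I S : Type} [Fintype I] [DecidableEq I] [Fintype S]

/-- The configuration `e_i` consisting of a single type-`i` customer. -/
def econf (i : I) : I → ℕ := Pi.single i 1

/-- `K^s`: the set of nonzero configurations of server type `s`. -/
def Kc (Kbar : S → Finset (I → ℕ)) (s : S) : Finset (I → ℕ) := (Kbar s).erase 0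

/-- Monotonicity of the configuration sets. -/
def KbarMono (Kbar : S → Finset (I → ℕ)) : Prop :=
  ∀ s, ∀ k ∈ Kbar s, ∀ k' : I → ℕ, (∀ i, k' i ≤ k i) → k' ∈ Kbar s

/-- Each configuration set contains the zero configuration. -/
def KbarZero (Kbar : S → Finset (I → ℕ)) : Prop := ∀ s, (0 : I → ℕ) ∈ Kbar s

/-- Every customer type can be served by some server type. -/
def KbarServe (Kbar : S → Finset (I → ℕ)) : Prop := ∀ i : I, ∃ s, econf i ∈ Kbar s

/-- `ℝ_+^K`: nonnegative vectors supported on the nonzero configurations. -/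
def orthK (Kbar : S → Finset (I → ℕ)) : Set (S → (I → ℕ) → ℝ) :=
  {x | (∀ s k, 0 ≤ x s k) ∧ ∀ s, ∀ k, k ∉ Kc Kbar s → x s k = 0}

/-- The feasible set `X` (equality constraints). -/
def feasX (Kbar : S → Finset (I → ℕ)) (ρ : I → ℝ) : Set (S → (I → ℕ) → ℝ) :=
  {x | x ∈ orthK Kbar ∧ ∀ i, ∑ s, ∑ k ∈ Kc Kbar s, (k i : ℝ) * x s k = ρ i}

/-- The relaxed feasible set (inequality constraints). -/
def feasXge (Kbar : S → Finset (I → ℕ)) (ρ : I → ℝ) : Set (S → (I → ℕ) → ℝ) :=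
  {x | x ∈ orthK Kbar ∧ ∀ i, ρ i ≤ ∑ s, ∑ k ∈ Kc Kbar s, (k i : ℝ) * x s k}

/-- The weighted number of occupied servers. -/
def objW (Kbar : S → Finset (I → ℕ)) (γ : S → ℝ) (x : S → (I → ℕ) → ℝ) : ℝ :=
  ∑ s, ∑ k ∈ Kc Kbar s, γ s * x s k

/-- `X*`: optimal solutions of LP=. -/
def XstarSet (Kbar : S → Finset (I → ℕ)) (ρ : I → ℝ) (γ : S → ℝ) :
    Set (S → (I → ℕ) → ℝ) :=
  {x | x ∈ feasX Kbar ρ ∧ ∀ y ∈ feasX Kbar ρ, objW Kbar γ x ≤ objW Kbar γ y}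

/-- `X**`: optimal solutions of LP≤. -/
def XstarSetGe (Kbar : S → Finset (I → ℕ)) (ρ : I → ℝ) (γ : S → ℝ) :
    Set (S → (I → ℕ) → ℝ) :=
  {x | x ∈ feasXge Kbar ρ ∧ ∀ y ∈ feasXge Kbar ρ, objW Kbar γ x ≤ objW Kbar γ y}

/-- `H*`: dual optimal vectors. -/
def HstarSet (Kbar : S → Finset (I → ℕ)) (ρ : I → ℝ) (γ : S → ℝ) : Set (I → ℝ) :=
  {η | ∃ x ∈ feasX Kbar ρ, (∀ i, 0 ≤ η i) ∧
    (∀ s, ∀ k ∈ Kc Kbar s, ∑ i, (k i : ℝ) * η i ≤ γ s) ∧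
    (∀ s, ∀ k ∈ Kc Kbar s, (∑ i, (k i : ℝ) * η i) < γ s → x s k = 0)}

/-- `c_k = ∏_i k_i!`. -/
def ck (k : I → ℕ) : ℝ := ∏ i, (Nat.factorial (k i) : ℝ)

/-- The function `L^{(a)}`. -/
def Lfun (Kbar : S → Finset (I → ℕ)) (a : S → ℝ) (x : S → (I → ℕ) → ℝ) : ℝ :=
  ∑ s, ∑ k ∈ Kc Kbar s, x s k * Real.log (x s k * ck k / (Real.exp 1 * a s))

/-- Product form (infinite-server system). -/
def prodForm (Kbar : S → Finset (I → ℕ)) (a : S → ℝ) (x : S → (I → ℕ) → ℝ)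
    (ν : I → ℝ) : Prop :=
  ∀ s, ∀ k ∈ Kc Kbar s, x s k = a s / ck k * Real.exp (∑ i, (k i : ℝ) * ν i)

/-- ℓ¹ distance on the coordinates indexed by `K`. -/
def distK (Kbar : S → Finset (I → ℕ)) (x y : S → (I → ℕ) → ℝ) : ℝ :=
  ∑ s, ∑ k ∈ Kc Kbar s, |x s k - y s k|

/-- Extended coordinate value: the zero configuration of type `s` has value `a_s`. -/
def xval (a : S → ℝ) (x : S → (I → ℕ) → ℝ) (s : S) (k : I → ℕ) : ℝ :=
  if k = 0 then a s else x s k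

/-- `x_{(i)}`: amount of servers available to a type-`i` arrival (GRAND(aZ)). -/
def xavail (Kbar : S → Finset (I → ℕ)) (a : S → ℝ) (x : S → (I → ℕ) → ℝ) (i : I) : ℝ :=
  ∑ s, ((if econf i ∈ Kc Kbar s then a s else 0)
    + ∑ k ∈ (Kc Kbar s).filter (fun k => k + econf i ∈ Kbar s), x s k)

/-- Departure rate `w_{k i}`. -/
def wrate (μ : I → ℝ) (x : S → (I → ℕ) → ℝ) (s : S) (k : I → ℕ) (i : I) : ℝ :=
  (k i : ℝ) * μ i * x s k

/-- Arrival rate `v_{k i}` (GRAND(aZ)), with `λ_i = μ_i ρ_i`. -/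
def vrate (Kbar : S → Finset (I → ℕ)) (a : S → ℝ) (μ ρ : I → ℝ)
    (x : S → (I → ℕ) → ℝ) (s : S) (k : I → ℕ) (i : I) : ℝ :=
  μ i * ρ i * xval a x s (k - econf i) / xavail Kbar a x i

/-- The GRAND(aZ) fluid vector field `F_k(x)`, for `k ∈ K^s`. -/
def Fdrift (Kbar : S → Finset (I → ℕ)) (a : S → ℝ) (μ ρ : I → ℝ)
    (x : S → (I → ℕ) → ℝ) (s : S) (k : I → ℕ) : ℝ :=
  (∑ i ∈ Finset.univ.filter (fun i : I => 1 ≤ k i ∧ k - econf i ∈ Kbar s),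
    (vrate Kbar a μ ρ x s k i - wrate μ x s k i))
  - ∑ i ∈ Finset.univ.filter (fun i : I => k + econf i ∈ Kbar s),
    (vrate Kbar a μ ρ x s (k + econf i) i - wrate μ x s (k + econf i) i)

/-- The function `Ξ(x)` (GRAND(aZ)). -/
def Xi (Kbar : S → Finset (I → ℕ)) (a : S → ℝ) (μ : I → ℝ)
    (x : S → (I → ℕ) → ℝ) : ℝ :=
  ∑ i : I, ∑ s : S,
    ∑ k ∈ (Kc Kbar s).filter (fun k => 1 ≤ k i ∧ k - econf i ∈ Kbar s),
      ∑ s' : S,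
        ∑ k' ∈ (Kc Kbar s').filter (fun k' => 1 ≤ k' i ∧ k' - econf i ∈ Kbar s'),
          (Real.log ((k' i : ℝ) * xval a x s (k - econf i) * x s' k')
            - Real.log ((k i : ℝ) * x s k * xval a x s' (k' - econf i)))
          * ((k i : ℝ) * μ i * x s k * xval a x s' (k' - econf i) / xavail Kbar a x i)

open Classical in
/-- `Ξ` extended by `−∞` to points with a vanishing coordinate, as a map into `[−∞, 0] ⊆ EReal`. -/
def XiE (Kbar : S → Finset (I → ℕ)) (a : S → ℝ) (μ : I → ℝ)
    (x : S → (I → ℕ) → ℝ) : EReal :=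
  if ∀ s, ∀ k ∈ Kc Kbar s, 0 < x s k then ((Xi Kbar a μ x : ℝ) : EReal) else ⊥

/-! Finite-server (GRAND-F) objects. -/

/-- `X^□`. -/
def XBox (Kbar : S → Finset (I → ℕ)) (h : S → ℝ) : Set (S → (I → ℕ) → ℝ) :=
  {x | x ∈ orthK Kbar ∧ ∀ s, ∑ k ∈ Kc Kbar s, x s k ≤ h s}

/-- `x_{0^s} = h_s − Σ_{k∈K^s} x_k`. -/
def x0 (Kbar : S → Finset (I → ℕ)) (h : S → ℝ) (x : S → (I → ℕ) → ℝ) (s : S) : ℝ :=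
  h s - ∑ k ∈ Kc Kbar s, x s k

/-- `X^⋄ = X^□ ∩ X`. -/
def XDiamond (Kbar : S → Finset (I → ℕ)) (h : S → ℝ) (ρ : I → ℝ) :
    Set (S → (I → ℕ) → ℝ) := XBox Kbar h ∩ feasX Kbar ρ

/-- Assumption A: a feasible point with idle servers of every type. -/
def AssumptionA (Kbar : S → Finset (I → ℕ)) (h : S → ℝ) (ρ : I → ℝ) : Prop :=
  ∃ x ∈ XDiamond Kbar h ρ, ∀ s, 0 < x0 Kbar h x s

/-- The function `L^□`. -/
def LBox (Kbar : S → Finset (I → ℕ)) (h : S → ℝ) (x : S → (I → ℕ) → ℝ) : ℝ :=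
  ∑ s, (x0 Kbar h x s * Real.log (x0 Kbar h x s / Real.exp 1)
    + ∑ k ∈ Kc Kbar s, x s k * Real.log (x s k * ck k / Real.exp 1))

/-- Product form (finite-server system), including the zero configurations. -/
def prodFormBox (Kbar : S → Finset (I → ℕ)) (h : S → ℝ) (x : S → (I → ℕ) → ℝ)
    (ν : I → ℝ) (β : S → ℝ) : Prop :=
  ∀ s, x0 Kbar h x s = Real.exp (-β s) ∧
    ∀ k ∈ Kc Kbar s, x s k = Real.exp (-β s) / ck k * Real.exp (∑ i, (k i : ℝ) * ν i)

/-- Extended coordinate value for the finite-server system. -/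
def xvalBox (Kbar : S → Finset (I → ℕ)) (h : S → ℝ) (x : S → (I → ℕ) → ℝ)
    (s : S) (k : I → ℕ) : ℝ :=
  if k = 0 then x0 Kbar h x s else x s k

/-- `x_{(i)}` for the finite-server system (zero configurations included). -/
def xavailBox (Kbar : S → Finset (I → ℕ)) (h : S → ℝ) (x : S → (I → ℕ) → ℝ)
    (i : I) : ℝ :=
  ∑ s, ((if econf i ∈ Kc Kbar s then x0 Kbar h x s else 0)
    + ∑ k ∈ (Kc Kbar s).filter (fun k => k + econf i ∈ Kbar s), x s k)

/-- Arrival rate `v_{k i}` (GRAND-F), with `λ_i = μ_i ρ_i`. -/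
def vrateBox (Kbar : S → Finset (I → ℕ)) (h : S → ℝ) (μ ρ : I → ℝ)
    (x : S → (I → ℕ) → ℝ) (s : S) (k : I → ℕ) (i : I) : ℝ :=
  μ i * ρ i * xvalBox Kbar h x s (k - econf i) / xavailBox Kbar h x i

/-- The GRAND-F fluid vector field `F^□_k(x)`, for `k ∈ K^s`. -/
def FdriftBox (Kbar : S → Finset (I → ℕ)) (h : S → ℝ) (μ ρ : I → ℝ)
    (x : S → (I → ℕ) → ℝ) (s : S) (k : I → ℕ) : ℝ :=
  (∑ i ∈ Finset.univ.filter (fun i : I => 1 ≤ k i ∧ k - econf i ∈ Kbar s),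
    (vrateBox Kbar h μ ρ x s k i - wrate μ x s k i))
  - ∑ i ∈ Finset.univ.filter (fun i : I => k + econf i ∈ Kbar s),
    (vrateBox Kbar h μ ρ x s (k + econf i) i - wrate μ x s (k + econf i) i)

/-- The function `Ξ^□(x̄)`. -/
def XiBox (Kbar : S → Finset (I → ℕ)) (h : S → ℝ) (μ : I → ℝ)
    (x : S → (I → ℕ) → ℝ) : ℝ :=
  ∑ i : I, ∑ s : S,
    ∑ k ∈ (Kc Kbar s).filter (fun k => 1 ≤ k i ∧ k - econf i ∈ Kbar s),
      ∑ s' : S,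
        ∑ k' ∈ (Kc Kbar s').filter (fun k' => 1 ≤ k' i ∧ k' - econf i ∈ Kbar s'),
          (Real.log ((k' i : ℝ) * xvalBox Kbar h x s (k - econf i) * x s' k')
            - Real.log ((k i : ℝ) * x s k * xvalBox Kbar h x s' (k' - econf i)))
          * ((k i : ℝ) * μ i * x s k * xvalBox Kbar h x s' (k' - econf i)
              / xavailBox Kbar h x i)

/-- The doubly summed relative entropy between `A p * B q` and its transpose has a sign, and it
vanishes iff the ratios `A p / B p` agree. -/
theorem sum_log_sub_log_mul_nonpos_and_eq_zero_iff {α : Type*} (T : Finset α) (A B : α → ℝ) (c : ℝ)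
    (hc : 0 < c) (hA : ∀ p ∈ T, 0 < A p) (hB : ∀ p ∈ T, 0 < B p) :
    ∑ p ∈ T, ∑ q ∈ T, (Real.log (B p * A q) - Real.log (A p * B q)) * (A p * B q * c) ≤ 0 ∧
    (∑ p ∈ T, ∑ q ∈ T, (Real.log (B p * A q) - Real.log (A p * B q)) * (A p * B q * c) = 0 ↔
      ∀ p ∈ T, ∀ q ∈ T, B p * A q = A p * B q) := by
  have entropy : ∀ u v : ℝ, 0 < u → 0 < v →
      (Real.log u - Real.log v) * (v * c) ≤ (u - v) * c ∧
      ((Real.log u - Real.log v) * (v * c) = (u - v) * c → u = v) := by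
    intro u v hu hv
    have huv : 0 < u / v := by positivity
    rw [← Real.log_div hu.ne' hv.ne']
    have key : (u - v) * c = (u / v - 1) * (v * c) := by field_simp
    rw [key]
    refine ⟨mul_le_mul_of_nonneg_right (Real.log_le_sub_one_of_pos huv) (by positivity), ?_⟩
    intro h
    by_contra hne
    have h1 : u / v ≠ 1 := by
      rw [Ne, div_eq_one_iff_eq hv.ne']; exact hne
    have := Real.log_lt_sub_one_of_pos huv h1
    have := mul_lt_mul_of_pos_right this (show 0 < v * c by positivity)
    exact this.ne h
  have hzero : ∑ p ∈ T, ∑ q ∈ T, (B p * A q - A p * B q) * c = 0 := by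
    simp_rw [sub_mul, Finset.sum_sub_distrib]
    rw [sub_eq_zero, Finset.sum_comm]
    exact Finset.sum_congr rfl fun p _ => Finset.sum_congr rfl fun q _ => by ring
  have hle : ∀ p ∈ T, ∀ q ∈ T,
      (Real.log (B p * A q) - Real.log (A p * B q)) * (A p * B q * c)
        ≤ (B p * A q - A p * B q) * c := fun p hp q hq =>
    (entropy _ _ (mul_pos (hB p hp) (hA q hq)) (mul_pos (hA p hp) (hB q hq))).1
  have hle' : ∀ p ∈ T, ∑ q ∈ T, (Real.log (B p * A q) - Real.log (A p * B q)) * (A p * B q * c)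
        ≤ ∑ q ∈ T, (B p * A q - A p * B q) * c := fun p hp =>
    Finset.sum_le_sum (hle p hp)
  refine ⟨(Finset.sum_le_sum hle').trans_eq hzero, ?_, ?_⟩
  · intro h p hp q hq
    have h1 := (Finset.sum_eq_sum_iff_of_le hle').1 (h.trans hzero.symm) p hp
    have h2 := (Finset.sum_eq_sum_iff_of_le (hle p hp)).1 h1 q hq
    exact (entropy _ _ (mul_pos (hB p hp) (hA q hq)) (mul_pos (hA p hp) (hB q hq))).2 h2
  · intro h
    refine Finset.sum_eq_zero fun p hp => Finset.sum_eq_zero fun q hq => ?_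
    rw [h p hp q hq, sub_self, zero_mul]

/-- The logarithm of `x_k c_k / a_s`, extended to zero configurations. -/
def logRatio (a : S → ℝ) (x : S → (I → ℕ) → ℝ) (s : S) (k : I → ℕ) : ℝ :=
  Real.log (xval a x s k * ck k / a s)

theorem ck_pos (k : I → ℕ) : 0 < ck k :=
  Finset.prod_pos fun i _ => by exact_mod_cast Nat.factorial_pos (k i)

theorem ck_eq_mul_ck_sub_econf (k : I → ℕ) (i : I) (hk : 1 ≤ k i) :
    ck k = (k i : ℝ) * ck (k - econf i) := by
  unfold ck
  rw [← Finset.mul_prod_erase _ _ (Finset.mem_univ i),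
    ← Finset.mul_prod_erase _ (fun j => (((k - econf i) j).factorial : ℝ)) (Finset.mem_univ i),
    ← mul_assoc]
  congr 1
  · simp only [Pi.sub_apply, econf, Pi.single_eq_same]
    exact_mod_cast (Nat.mul_factorial_pred (by omega)).symm
  · refine Finset.prod_congr rfl fun j hj => ?_
    simp [econf, Pi.single_eq_of_ne (Finset.ne_of_mem_erase hj)]

theorem xval_pos (Kbar : S → Finset (I → ℕ)) (a : S → ℝ) (hapos : ∀ s, 0 < a s)
    (x : S → (I → ℕ) → ℝ) (hpos : ∀ s, ∀ k ∈ Kc Kbar s, 0 < x s k) (s : S) (k : I → ℕ)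
    (hk : k ∈ Kbar s) : 0 < xval a x s k := by
  unfold xval
  split_ifs with h
  · exact hapos s
  · exact hpos s k (Finset.mem_erase.2 ⟨h, hk⟩)

theorem logRatio_zero (a : S → ℝ) (hapos : ∀ s, 0 < a s) (x : S → (I → ℕ) → ℝ) (s : S) :
    logRatio a x s 0 = 0 := by
  simp [logRatio, xval, ck, (hapos s).ne']

theorem logRatio_of_mem (Kbar : S → Finset (I → ℕ)) (a : S → ℝ) (x : S → (I → ℕ) → ℝ) (s : S)
    (k : I → ℕ) (hk : k ∈ Kc Kbar s) :
    logRatio a x s k = Real.log (x s k * ck k / a s) := by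
  simp [logRatio, xval, (Finset.mem_erase.1 hk).1]

/-- The pairs `(s, k)` for which `(k, i)` is an edge. -/
def edges (Kbar : S → Finset (I → ℕ)) (i : I) : Finset (Σ _ : S, I → ℕ) :=
  Finset.univ.sigma fun s =>
    (Kc Kbar s).filter (fun k => 1 ≤ k i ∧ k - econf i ∈ Kbar s)

theorem mem_edges {Kbar : S → Finset (I → ℕ)} {i : I} {p : Σ _ : S, I → ℕ} :
    p ∈ edges Kbar i ↔ p.2 ∈ Kc Kbar p.1 ∧ 1 ≤ p.2 i ∧ p.2 - econf i ∈ Kbar p.1 := by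
  simp [edges]

theorem logRatio_sub_logRatio (Kbar : S → Finset (I → ℕ)) (a : S → ℝ) (hapos : ∀ s, 0 < a s)
    (x : S → (I → ℕ) → ℝ) (hpos : ∀ s, ∀ k ∈ Kc Kbar s, 0 < x s k) (i : I)
    (p : Σ _ : S, I → ℕ) (hp : p ∈ edges Kbar i) :
    logRatio a x p.1 p.2 - logRatio a x p.1 (p.2 - econf i) =
      Real.log ((p.2 i : ℝ) * x p.1 p.2) - Real.log (xval a x p.1 (p.2 - econf i)) := by
  obtain ⟨hk, h1, hm⟩ := mem_edges.1 hp
  have hx := hpos _ _ hk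
  have hv := xval_pos Kbar a hapos x hpos _ _ hm
  have ha := hapos p.1
  have hc := ck_pos (p.2 - econf i)
  have hi : (0 : ℝ) < p.2 i := by exact_mod_cast h1
  rw [logRatio_of_mem Kbar a x _ _ hk, logRatio, ck_eq_mul_ck_sub_econf _ _ h1,
    ← Real.log_div (by positivity) (by positivity), ← Real.log_div (by positivity) (by positivity)]
  congr 1
  field_simp

/-- The increments of `logRatio` along type-`i` arrivals do not depend on the configuration. -/
def IncrementsAgree (Kbar : S → Finset (I → ℕ)) (a : S → ℝ) (x : S → (I → ℕ) → ℝ) : Prop :=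
  ∀ i, ∀ p ∈ edges Kbar i, ∀ q ∈ edges Kbar i,
    logRatio a x p.1 p.2 - logRatio a x p.1 (p.2 - econf i) =
      logRatio a x q.1 q.2 - logRatio a x q.1 (q.2 - econf i)

theorem xavail_pos (Kbar : S → Finset (I → ℕ)) (hserve : KbarServe Kbar) (a : S → ℝ)
    (hapos : ∀ s, 0 < a s) (x : S → (I → ℕ) → ℝ) (hpos : ∀ s, ∀ k ∈ Kc Kbar s, 0 < x s k) (i : I) :
    0 < xavail Kbar a x i := by
  have hsum : ∀ s, 0 ≤ ∑ k ∈ (Kc Kbar s).filter (fun k => k + econf i ∈ Kbar s), x s k :=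
    fun s => Finset.sum_nonneg fun k hk => (hpos s k (Finset.mem_filter.1 hk).1).le
  obtain ⟨s, hs⟩ := hserve i
  have hmem : econf i ∈ Kc Kbar s := by
    refine Finset.mem_erase.2 ⟨fun h => ?_, hs⟩
    have := congrFun h i
    simp [econf] at this
  refine Finset.sum_pos' (fun t _ => add_nonneg ?_ (hsum t)) ⟨s, Finset.mem_univ s, ?_⟩
  · split_ifs
    · exact (hapos t).le
    · exact le_rfl
  · rw [if_pos hmem]
    exact add_pos_of_pos_of_nonneg (hapos s) (hsum s)

theorem Xi_nonpos_and_eq_zero_iff_incrementsAgree (Kbar : S → Finset (I → ℕ))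
    (hserve : KbarServe Kbar) (a : S → ℝ) (hapos : ∀ s, 0 < a s) (μ : I → ℝ) (hμpos : ∀ i, 0 < μ i)
    (x : S → (I → ℕ) → ℝ) (hpos : ∀ s, ∀ k ∈ Kc Kbar s, 0 < x s k) :
    Xi Kbar a μ x ≤ 0 ∧ (Xi Kbar a μ x = 0 ↔ IncrementsAgree Kbar a x) := by
  let A : I → (Σ _ : S, I → ℕ) → ℝ := fun i p => (p.2 i : ℝ) * x p.1 p.2
  let B : I → (Σ _ : S, I → ℕ) → ℝ := fun i p => xval a x p.1 (p.2 - econf i)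
  have hA : ∀ i, ∀ p ∈ edges Kbar i, 0 < A i p := fun i p hp => by
    obtain ⟨hk, h1, hm⟩ := mem_edges.1 hp
    exact mul_pos (by exact_mod_cast h1) (hpos _ _ hk)
  have hB : ∀ i, ∀ p ∈ edges Kbar i, 0 < B i p := fun i p hp =>
    xval_pos Kbar a hapos x hpos _ _ (mem_edges.1 hp).2.2
  have hXi : Xi Kbar a μ x = ∑ i, ∑ p ∈ edges Kbar i, ∑ q ∈ edges Kbar i,
      (Real.log (B i p * A i q) - Real.log (A i p * B i q)) *
        (A i p * B i q * (μ i / xavail Kbar a x i)) := by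
    unfold Xi edges
    refine Finset.sum_congr rfl fun i _ => ?_
    rw [Finset.sum_sigma]
    refine Finset.sum_congr rfl fun s _ => Finset.sum_congr rfl fun k _ => ?_
    rw [Finset.sum_sigma]
    refine Finset.sum_congr rfl fun s' _ => Finset.sum_congr rfl fun k' _ => ?_
    simp only [A, B]
    congr 1
    · congr 2
      ring
    · ring
  have key := fun i => sum_log_sub_log_mul_nonpos_and_eq_zero_iff (edges Kbar i) (A i) (B i)
    (μ i / xavail Kbar a x i) (div_pos (hμpos i) (xavail_pos Kbar hserve a hapos x hpos i))
    (hA i) (hB i)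
  rw [hXi]
  refine ⟨Finset.sum_nonpos fun i _ => (key i).1, ?_⟩
  rw [Finset.sum_eq_zero_iff_of_nonpos fun i _ => (key i).1]
  simp only [Finset.mem_univ, true_imp_iff, IncrementsAgree]
  refine forall_congr' fun i => ?_
  rw [(key i).2]
  refine forall₂_congr fun p hp => forall₂_congr fun q hq => ?_
  rw [logRatio_sub_logRatio Kbar a hapos x hpos i p hp,
    logRatio_sub_logRatio Kbar a hapos x hpos i q hq]
  change _ ↔ Real.log (A i p) - Real.log (B i p) = Real.log (A i q) - Real.log (B i q)
  have hAp := hA i p hp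
  have hAq := hA i q hq
  have hBp := hB i p hp
  have hBq := hB i q hq
  have hinj : B i p * A i q = A i p * B i q ↔
      Real.log (B i p * A i q) = Real.log (A i p * B i q) :=
    (Real.log_injOn_pos.eq_iff (mul_pos hBp hAq) (mul_pos hAp hBq)).symm
  rw [hinj, Real.log_mul hBp.ne' hAq.ne', Real.log_mul hAp.ne' hBq.ne']
  constructor <;> intro h <;> linarith

theorem exists_logRatio_eq_sum (Kbar : S → Finset (I → ℕ)) (hmono : KbarMono Kbar) (a : S → ℝ)
    (hapos : ∀ s, 0 < a s) (x : S → (I → ℕ) → ℝ) (h : IncrementsAgree Kbar a x) :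
    ∃ ν : I → ℝ, ∀ s, ∀ k ∈ Kbar s, logRatio a x s k = ∑ i, (k i : ℝ) * ν i := by
  have hν : ∀ i, ∃ ν : ℝ, ∀ p ∈ edges Kbar i,
      logRatio a x p.1 p.2 - logRatio a x p.1 (p.2 - econf i) = ν := by
    intro i
    rcases (edges Kbar i).eq_empty_or_nonempty with he | ⟨q, hq⟩
    · exact ⟨0, fun p hp => by simp [he] at hp⟩
    · exact ⟨_, fun p hp => h i p hp q hq⟩
  choose ν hν using hν
  refine ⟨ν, fun s => ?_⟩
  suffices H : ∀ n : ℕ, ∀ k ∈ Kbar s, ∑ i, k i = n →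
      logRatio a x s k = ∑ i, (k i : ℝ) * ν i from fun k hk => H _ k hk rfl
  intro n
  induction n with
  | zero =>
    intro k _ hn
    have hk0 : k = 0 := by
      funext i
      exact (Finset.sum_eq_zero_iff.1 hn) i (Finset.mem_univ i)
    subst hk0
    simp [logRatio_zero a hapos]
  | succ n ih =>
    intro k hk hn
    obtain ⟨i, hi⟩ : ∃ i, 1 ≤ k i := by
      by_contra! hcon
      have : ∑ i, k i = 0 := Finset.sum_eq_zero fun i _ => by have := hcon i; omega
      omega
    have hm : k - econf i ∈ Kbar s := hmono s k hk _ fun j => Nat.sub_le _ _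
    have hkc : k ∈ Kc Kbar s := Finset.mem_erase.2 ⟨fun h0 => by simp [h0] at hi, hk⟩
    have hdecomp : k = (k - econf i) + econf i := by
      funext j
      by_cases hj : j = i
      · subst hj; simp [econf]; omega
      · simp [econf, Pi.single_eq_of_ne hj]
    have hstep := hν i ⟨s, k⟩ (mem_edges.2 ⟨hkc, hi, hm⟩)
    have hsum1 : ∑ j, econf i j = 1 := by simp [econf]
    have hn' : ∑ j, (k - econf i) j = n := by
      have : ∑ j, k j = ∑ j, (k - econf i) j + ∑ j, econf i j := by
        rw [← Finset.sum_add_distrib]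
        exact Finset.sum_congr rfl fun j _ => congrFun hdecomp j
      omega
    have hih := ih _ hm hn'
    have hsplit : ∑ j, (k j : ℝ) * ν j = ∑ j, ((k - econf i) j : ℝ) * ν j + ν i := by
      have : ∑ j, (econf i j : ℝ) * ν j = ν i := by
        simp [econf, Pi.single_apply]
      rw [← this, ← Finset.sum_add_distrib]
      refine Finset.sum_congr rfl fun j _ => ?_
      have := congrFun hdecomp j
      rw [Pi.add_apply] at this
      rw [← add_mul, ← Nat.cast_add, ← this]
    rw [hsplit, ← hih]
    simp only at hstep
    linarith

theorem sum_logRatio_eq_zero_of_sum_eq_zero (Kbar : S → Finset (I → ℕ)) (a : S → ℝ)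
    (x : S → (I → ℕ) → ℝ) (ν : I → ℝ)
    (hν : ∀ s, ∀ k ∈ Kbar s, logRatio a x s k = ∑ i, (k i : ℝ) * ν i) (d : S → (I → ℕ) → ℝ)
    (hd : ∀ i, ∑ s, ∑ k ∈ Kc Kbar s, (k i : ℝ) * d s k = 0) :
    ∑ s, ∑ k ∈ Kc Kbar s, d s k * logRatio a x s k = 0 := by
  calc ∑ s, ∑ k ∈ Kc Kbar s, d s k * logRatio a x s k
      = ∑ s, ∑ k ∈ Kc Kbar s, ∑ i, ν i * ((k i : ℝ) * d s k) := by
        refine Finset.sum_congr rfl fun s _ => Finset.sum_congr rfl fun k hk => ?_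
        rw [hν s k (Finset.mem_of_mem_erase hk), Finset.mul_sum]
        exact Finset.sum_congr rfl fun i _ => by ring
    _ = ∑ i, ν i * ∑ s, ∑ k ∈ Kc Kbar s, (k i : ℝ) * d s k := by
        simp_rw [Finset.mul_sum]
        symm
        rw [Finset.sum_comm]
        exact Finset.sum_congr rfl fun s _ => Finset.sum_comm
    _ = 0 := by simp [hd]

/-- Tangent-line inequality for `t ↦ t log (t / (e b))` at `u`, with its equality case. -/
theorem mul_log_div_tangent {u v b : ℝ} (hu : 0 < u) (hv : 0 ≤ v) (hb : 0 < b) :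
    u * Real.log (u * b⁻¹ / Real.exp 1) + (v - u) * Real.log (u * b⁻¹)
      ≤ v * Real.log (v * b⁻¹ / Real.exp 1) ∧
    (u * Real.log (u * b⁻¹ / Real.exp 1) + (v - u) * Real.log (u * b⁻¹)
      = v * Real.log (v * b⁻¹ / Real.exp 1) → u = v) := by
  have hbi : b⁻¹ ≠ 0 := by positivity
  rw [Real.log_div (by positivity) (Real.exp_pos 1).ne', Real.log_exp,
    Real.log_mul hu.ne' hbi]
  rcases hv.eq_or_lt with rfl | hv'
  · simp only [zero_mul]
    constructor
    · nlinarith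
    · intro h; nlinarith
  · rw [Real.log_div (by positivity) (Real.exp_pos 1).ne', Real.log_exp,
      Real.log_mul hv'.ne' hbi]
    have hq : 0 < u / v := by positivity
    have hlog : Real.log (u / v) = Real.log u - Real.log v := Real.log_div hu.ne' hv'.ne'
    have hmul : v * (u / v - 1) = u - v := by field_simp
    constructor
    · have h1 := mul_le_mul_of_nonneg_left (Real.log_le_sub_one_of_pos hq) hv
      rw [hmul, hlog] at h1
      linarith
    · intro h
      by_contra hne
      have h1 := mul_lt_mul_of_pos_left (Real.log_lt_sub_one_of_pos hq
        (by rw [Ne, div_eq_one_iff_eq hv'.ne']; exact hne)) hv'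
      rw [hmul, hlog] at h1
      linarith

theorem eq_of_incrementsAgree_of_Lfun_le (Kbar : S → Finset (I → ℕ)) (hmono : KbarMono Kbar)
    (ρ : I → ℝ) (a : S → ℝ) (hapos : ∀ s, 0 < a s) (x y : S → (I → ℕ) → ℝ)
    (hx : x ∈ feasX Kbar ρ) (hy : y ∈ feasX Kbar ρ) (hpos : ∀ s, ∀ k ∈ Kc Kbar s, 0 < x s k)
    (h : IncrementsAgree Kbar a x) (hle : Lfun Kbar a y ≤ Lfun Kbar a x) : x = y := by
  obtain ⟨ν, hν⟩ := exists_logRatio_eq_sum Kbar hmono a hapos x h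
  have hzero := sum_logRatio_eq_zero_of_sum_eq_zero Kbar a x ν hν (fun s k => y s k - x s k)
    (fun i => by simp_rw [mul_sub, Finset.sum_sub_distrib]; rw [hy.2 i, hx.2 i, sub_self])
  have hform : ∀ (z : S → (I → ℕ) → ℝ) (s : S) (k : I → ℕ),
      z s k * ck k / (Real.exp 1 * a s) = z s k * (a s / ck k)⁻¹ / Real.exp 1 := by
    intro z s k
    rw [inv_div]
    have := hapos s
    field_simp
  have htan : ∀ s, ∀ k ∈ Kc Kbar s,
      x s k * Real.log (x s k * ck k / (Real.exp 1 * a s)) + (y s k - x s k) * logRatio a x s k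
        ≤ y s k * Real.log (y s k * ck k / (Real.exp 1 * a s)) ∧
      (x s k * Real.log (x s k * ck k / (Real.exp 1 * a s)) + (y s k - x s k) * logRatio a x s k
        = y s k * Real.log (y s k * ck k / (Real.exp 1 * a s)) → x s k = y s k) := by
    intro s k hk
    have := mul_log_div_tangent (hpos s k hk) (hy.1.1 s k) (div_pos (hapos s) (ck_pos k))
    rw [logRatio_of_mem Kbar a x s k hk, hform, hform]
    rwa [show x s k * (a s / ck k)⁻¹ = x s k * ck k / a s by rw [inv_div, mul_div_assoc]] at this ⊢
  have hle1 := fun s (_ : s ∈ Finset.univ) =>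
    Finset.sum_le_sum fun k hk => (htan s k hk).1
  have heq : ∑ s, ∑ k ∈ Kc Kbar s, (x s k * Real.log (x s k * ck k / (Real.exp 1 * a s))
      + (y s k - x s k) * logRatio a x s k)
      = ∑ s, ∑ k ∈ Kc Kbar s, y s k * Real.log (y s k * ck k / (Real.exp 1 * a s)) := by
    refine le_antisymm (Finset.sum_le_sum hle1) ?_
    simp_rw [Finset.sum_add_distrib]
    rw [hzero, add_zero]
    exact hle
  funext s k
  by_cases hk : k ∈ Kc Kbar s
  · have h1 := (Finset.sum_eq_sum_iff_of_le hle1).1 heq s (Finset.mem_univ s)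
    exact (htan s k hk).2
      ((Finset.sum_eq_sum_iff_of_le fun k hk => (htan s k hk).1).1 h1 k hk)
  · rw [hx.1.2 s k hk, hy.1.2 s k hk]

/-- First-order optimality of a strictly positive minimizer in feasible directions. -/
theorem sum_mul_logRatio_eq_zero_of_minimizer (Kbar : S → Finset (I → ℕ)) (ρ : I → ℝ) (a : S → ℝ)
    (hapos : ∀ s, 0 < a s) (x : S → (I → ℕ) → ℝ) (hx : x ∈ feasX Kbar ρ)
    (hpos : ∀ s, ∀ k ∈ Kc Kbar s, 0 < x s k)
    (hmin : ∀ y ∈ feasX Kbar ρ, Lfun Kbar a x ≤ Lfun Kbar a y) (d : S → (I → ℕ) → ℝ)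
    (hsupp : ∀ s, ∀ k, k ∉ Kc Kbar s → d s k = 0)
    (hd : ∀ i, ∑ s, ∑ k ∈ Kc Kbar s, (k i : ℝ) * d s k = 0) :
    ∑ s, ∑ k ∈ Kc Kbar s, d s k * logRatio a x s k = 0 := by
  have hev : ∀ᶠ t : ℝ in 𝓝 0, ∀ s, ∀ k ∈ Kc Kbar s, 0 < x s k + t * d s k := by
    refine Filter.eventually_all.2 fun s => (Finset.eventually_all _).2 fun k hk => ?_
    have hcont : Continuous fun t : ℝ => x s k + t * d s k := by fun_prop
    exact hcont.continuousAt.eventually_const_lt (by simpa using hpos s k hk)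
  have hloc : IsLocalMin (fun t : ℝ => Lfun Kbar a fun s k => x s k + t * d s k) 0 := by
    filter_upwards [hev] with t ht
    simp only [zero_mul, add_zero]
    refine hmin _ ⟨⟨fun s k => ?_, fun s k hk => ?_⟩, fun i => ?_⟩
    · by_cases hk : k ∈ Kc Kbar s
      · exact (ht s k hk).le
      · simp [hx.1.2 s k hk, hsupp s k hk]
    · simp [hx.1.2 s k hk, hsupp s k hk]
    · have : ∑ s, ∑ k ∈ Kc Kbar s, (k i : ℝ) * (x s k + t * d s k)
          = ∑ s, ∑ k ∈ Kc Kbar s, (k i : ℝ) * x s k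
            + t * ∑ s, ∑ k ∈ Kc Kbar s, (k i : ℝ) * d s k := by
        simp_rw [Finset.mul_sum, ← Finset.sum_add_distrib]
        exact Finset.sum_congr rfl fun s _ => Finset.sum_congr rfl fun k _ => by ring
      rw [this, hd i, hx.2 i, mul_zero, add_zero]
  have hderiv : HasDerivAt (fun t : ℝ => Lfun Kbar a fun s k => x s k + t * d s k)
      (∑ s, ∑ k ∈ Kc Kbar s, d s k * logRatio a x s k) 0 := by
    unfold Lfun
    refine HasDerivAt.fun_sum fun s _ => HasDerivAt.fun_sum fun k hk => ?_
    have hxk := hpos s k hk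
    have hak := hapos s
    have hck := ck_pos k
    have hlin : HasDerivAt (fun t : ℝ => x s k + t * d s k) (d s k) 0 := by
      simpa using ((hasDerivAt_id (0 : ℝ)).mul_const (d s k)).const_add (x s k)
    have hlog := ((hlin.mul_const (ck k)).div_const (Real.exp 1 * a s)).log
      (by simp only [zero_mul, add_zero]; positivity)
    refine (hlin.mul hlog).congr_deriv ?_
    rw [logRatio_of_mem Kbar a x s k hk]
    simp only [zero_mul, add_zero]
    rw [show x s k * ck k / (Real.exp 1 * a s) = x s k * ck k / a s / Real.exp 1 by field_simp,
      Real.log_div (by positivity) (Real.exp_pos 1).ne', Real.log_exp]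
    field_simp
    ring
  exact hloc.hasDerivAt_eq_zero hderiv

open Classical in
theorem incrementsAgree_of_minimizer (Kbar : S → Finset (I → ℕ)) (ρ : I → ℝ) (a : S → ℝ)
    (hapos : ∀ s, 0 < a s) (x : S → (I → ℕ) → ℝ) (hx : x ∈ feasX Kbar ρ)
    (hpos : ∀ s, ∀ k ∈ Kc Kbar s, 0 < x s k)
    (hmin : ∀ y ∈ feasX Kbar ρ, Lfun Kbar a x ≤ Lfun Kbar a y) : IncrementsAgree Kbar a x := by
  intro i p hp q hq
  obtain ⟨hpk, hp1, hpm⟩ := mem_edges.1 hp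
  obtain ⟨hqk, hq1, hqm⟩ := mem_edges.1 hq
  let δ : S → (I → ℕ) → S → (I → ℕ) → ℝ := fun s k t l =>
    if k ∈ Kc Kbar s then Pi.single (M := fun _ => (I → ℕ) → ℝ) s (Pi.single k 1) t l else 0
  have hδ : ∀ (f : S → (I → ℕ) → ℝ) (s : S) (k : I → ℕ), k ∈ Kbar s → f s 0 = 0 →
      ∑ t, ∑ l ∈ Kc Kbar t, δ s k t l * f t l = f s k := by
    intro f s k hk hf
    by_cases hkc : k ∈ Kc Kbar s
    · rw [Finset.sum_eq_single s, Finset.sum_eq_single k]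
      · simp [δ, hkc]
      · intro l _ hl; simp [δ, hl]
      · exact fun hn => absurd hkc hn
      · intro t _ ht
        exact Finset.sum_eq_zero fun l _ => by simp [δ, Pi.single_eq_of_ne ht]
      · simp
    · have hk0 : k = 0 := by
        by_contra hne
        exact hkc (Finset.mem_erase.2 ⟨hne, hk⟩)
      simp only [δ, if_neg hkc, zero_mul, Finset.sum_const_zero]
      rw [hk0, hf]
  let d : S → (I → ℕ) → ℝ := fun t l =>
    δ p.1 p.2 t l - δ p.1 (p.2 - econf i) t l - (δ q.1 q.2 t l - δ q.1 (q.2 - econf i) t l)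
  have hdsum : ∀ f : S → (I → ℕ) → ℝ, (∀ s, f s 0 = 0) →
      ∑ t, ∑ l ∈ Kc Kbar t, d t l * f t l =
        f p.1 p.2 - f p.1 (p.2 - econf i) - (f q.1 q.2 - f q.1 (q.2 - econf i)) := by
    intro f hf
    simp only [d, sub_mul, Finset.sum_sub_distrib]
    rw [hδ f _ _ (Finset.mem_of_mem_erase hpk) (hf _), hδ f _ _ hpm (hf _),
      hδ f _ _ (Finset.mem_of_mem_erase hqk) (hf _), hδ f _ _ hqm (hf _)]
  have hδsupp : ∀ s k t l, l ∉ Kc Kbar t → δ s k t l = 0 := by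
    intro s k t l hl
    simp only [δ]
    split_ifs with hk
    · by_cases ht : t = s
      · subst ht
        have : l ≠ k := fun h => hl (h ▸ hk)
        simp [this]
      · simp [Pi.single_eq_of_ne ht]
    · rfl
  have hmain := sum_mul_logRatio_eq_zero_of_minimizer Kbar ρ a hapos x hx hpos hmin d
    (fun t l hl => by simp [d, hδsupp _ _ t l hl]) (fun j => by
      have hcast : ∀ r : Σ _ : S, I → ℕ, 1 ≤ r.2 i →
          (r.2 j : ℝ) - ((r.2 - econf i) j : ℕ) = (econf i j : ℕ) := by
        intro r hr
        have : econf i j ≤ r.2 j := by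
          by_cases hj : j = i
          · subst hj; simpa [econf] using hr
          · simp [econf, Pi.single_eq_of_ne hj]
        rw [Pi.sub_apply, Nat.cast_sub this]
        ring
      simp_rw [mul_comm _ (d _ _)]
      rw [hdsum (fun _ l => (l j : ℝ)) (fun s => by simp), hcast p hp1, hcast q hq1, sub_self])
  rw [hdsum _ (logRatio_zero a hapos x)] at hmain
  linarith

/-- `Ξ(x) ≤ 0` on strictly positive points of `X`, with equality iff
`x = x^{*,a}`. -/
theorem Xi_nonpos_eq_zero_iff_minimizer
    (Kbar : S → Finset (I → ℕ))
    (hmono : KbarMono Kbar) (hzero : KbarZero Kbar) (hserve : KbarServe Kbar)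
    (ρ : I → ℝ) (hρpos : ∀ i, 0 < ρ i) (hρsum : ∑ i, ρ i = 1)
    (a : S → ℝ) (hapos : ∀ s, 0 < a s)
    (μ : I → ℝ) (hμpos : ∀ i, 0 < μ i)
    (xstar : S → (I → ℕ) → ℝ) (hxstar : xstar ∈ feasX Kbar ρ)
    (hmin : ∀ y ∈ feasX Kbar ρ, Lfun Kbar a xstar ≤ Lfun Kbar a y)
    (x : S → (I → ℕ) → ℝ) (hx : x ∈ feasX Kbar ρ)
    (hpos : ∀ s, ∀ k ∈ Kc Kbar s, 0 < x s k) :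
    Xi Kbar a μ x ≤ 0 ∧ (Xi Kbar a μ x = 0 ↔ x = xstar) := by
  obtain ⟨hle, hiff⟩ :=
    Xi_nonpos_and_eq_zero_iff_incrementsAgree Kbar hserve a hapos μ hμpos x hpos
  refine ⟨hle, hiff.trans ⟨fun h => ?_, fun h => ?_⟩⟩
  · exact eq_of_incrementsAgree_of_Lfun_le Kbar hmono ρ a hapos x xstar hx hxstar hpos h
      (hmin x hx)
  · subst h
    exact incrementsAgree_of_minimizer Kbar ρ a hapos x hx hpos hmin
end
end

section
/- For every δ > 0 there exists δ_1 > 0 such that for every differentiable function x : [0,∞) → X satisfying x'(t) = F(x(t)) for all t ≥ 0, one has x_k(t) ≥ δ_1 for all k ∈ K and all t ≥ δ; the constant δ_1 depends only on δ and the system parameters, not on the particular solution. -/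
open scoped BigOperators
open Filter Topology

noncomputable section

variable {I S : Type} [Fintype I] [DecidableEq I] [Fintype S]

/-- Scalar comparison: a nonnegative function with `f' ≥ b - C f` on `[t₀, ∞)` dominates the
solution of `y' = b - C y`, `y t₀ = 0`. -/
theorem le_of_hasDerivAt_ge_sub_mul {f f' : ℝ → ℝ} {t₀ b C : ℝ} (hC : 0 < C)
    (hf : ∀ t, t₀ ≤ t → HasDerivAt f (f' t) t)
    (hf' : ∀ t, t₀ ≤ t → b - C * f t ≤ f' t) (h₀ : 0 ≤ f t₀) {t : ℝ} (ht : t₀ ≤ t) :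
    b / C * (1 - Real.exp (-(C * (t - t₀)))) ≤ f t := by
  have hderiv : ∀ u, t₀ ≤ u → HasDerivAt (fun u => Real.exp (C * (u - t₀)) * (f u - b / C))
      (Real.exp (C * (u - t₀)) * C * (f u - b / C) + Real.exp (C * (u - t₀)) * f' u) u := by
    intro u hu
    have hexp : HasDerivAt (fun u => Real.exp (C * (u - t₀))) (Real.exp (C * (u - t₀)) * C) u := by
      simpa using (((hasDerivAt_id u).sub_const t₀).const_mul C).exp
    exact hexp.mul ((hf u hu).sub_const _)
  have hmon : MonotoneOn (fun u => Real.exp (C * (u - t₀)) * (f u - b / C)) (Set.Ici t₀) := by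
    refine monotoneOn_of_hasDerivWithinAt_nonneg (convex_Ici t₀)
      (fun u hu => (hderiv u hu).continuousAt.continuousWithinAt)
      (fun u hu => (hderiv u (interior_subset hu)).hasDerivWithinAt) fun u hu => ?_
    have hCb : C * (b / C) = b := by field_simp
    calc (0 : ℝ) ≤ Real.exp (C * (u - t₀)) * (f' u - (b - C * f u)) :=
          mul_nonneg (Real.exp_pos _).le (sub_nonneg.2 (hf' u (interior_subset hu)))
      _ = _ := by linear_combination (-Real.exp (C * (u - t₀))) * (-hCb)
  have hle : f t₀ - b / C ≤ Real.exp (C * (t - t₀)) * (f t - b / C) := by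
    simpa using hmon Set.self_mem_Ici ht ht
  have hmul := mul_le_mul_of_nonneg_left hle (Real.exp_pos (-(C * (t - t₀)))).le
  rw [← mul_assoc, ← Real.exp_add, neg_add_cancel, Real.exp_zero, one_mul] at hmul
  nlinarith [mul_nonneg (Real.exp_pos (-(C * (t - t₀)))).le h₀]

set_option linter.unusedSectionVars false in
/-- Every coordinate of a feasible point is at most one. -/
theorem feasX_le_one {Kbar : S → Finset (I → ℕ)} {ρ : I → ℝ} (hρpos : ∀ i, 0 < ρ i)
    (hρsum : ∑ i, ρ i = 1) {x : S → (I → ℕ) → ℝ} (hx : x ∈ feasX Kbar ρ)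
    {s : S} {k : I → ℕ} (hk : k ∈ Kc Kbar s) : x s k ≤ 1 := by
  obtain ⟨⟨hnonneg, -⟩, hsum⟩ := hx
  obtain ⟨i, hi⟩ := Function.ne_iff.1 (Finset.ne_of_mem_erase hk)
  have hterm : ∀ s k, 0 ≤ (k i : ℝ) * x s k := fun s k => mul_nonneg (Nat.cast_nonneg _) (hnonneg s k)
  calc x s k ≤ (k i : ℝ) * x s k :=
        le_mul_of_one_le_left (hnonneg s k) (by exact_mod_cast Nat.one_le_iff_ne_zero.2 hi)
    _ ≤ ∑ k ∈ Kc Kbar s, (k i : ℝ) * x s k :=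
        Finset.single_le_sum (f := fun k => (k i : ℝ) * x s k) (fun k _ => hterm s k) hk
    _ ≤ ∑ s, ∑ k ∈ Kc Kbar s, (k i : ℝ) * x s k :=
        Finset.single_le_sum (f := fun s => ∑ k ∈ Kc Kbar s, (k i : ℝ) * x s k)
          (fun s _ => Finset.sum_nonneg fun k _ => hterm s k) (Finset.mem_univ s)
    _ = ρ i := hsum i
    _ ≤ ∑ i, ρ i := Finset.single_le_sum (fun i _ => (hρpos i).le) (Finset.mem_univ i)
    _ = 1 := hρsum

/-- `x_{(i)}` is bounded below by a positive constant on the nonnegative orthant. -/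
theorem exists_pos_le_xavail {Kbar : S → Finset (I → ℕ)} (hserve : KbarServe Kbar)
    {a : S → ℝ} (hapos : ∀ s, 0 < a s) (i : I) :
    ∃ A > (0 : ℝ), ∀ x ∈ orthK Kbar, A ≤ xavail Kbar a x i := by
  obtain ⟨s, hs⟩ := hserve i
  have hmem : econf i ∈ Kc Kbar s := Finset.mem_erase.2 ⟨by simp [econf], hs⟩
  refine ⟨a s, hapos s, fun x hx => ?_⟩
  have hsum : ∀ s, 0 ≤ ∑ k ∈ (Kc Kbar s).filter (fun k => k + econf i ∈ Kbar s), x s k :=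
    fun s => Finset.sum_nonneg fun k _ => hx.1 s k
  have hite : ∀ s, 0 ≤ if econf i ∈ Kc Kbar s then a s else 0 := fun s => by
    split_ifs
    exacts [(hapos s).le, le_rfl]
  calc a s ≤ (if econf i ∈ Kc Kbar s then a s else 0)
        + ∑ k ∈ (Kc Kbar s).filter (fun k => k + econf i ∈ Kbar s), x s k := by
        rw [if_pos hmem]
        exact le_add_of_nonneg_right (hsum s)
    _ ≤ xavail Kbar a x i :=
        Finset.single_le_sum (f := fun s => (if econf i ∈ Kc Kbar s then a s else 0)
          + ∑ k ∈ (Kc Kbar s).filter (fun k => k + econf i ∈ Kbar s), x s k)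
          (fun s _ => add_nonneg (hite s) (hsum s)) (Finset.mem_univ s)

/-- `x_{(i)}` is bounded above on the feasible set. -/
theorem exists_xavail_le {Kbar : S → Finset (I → ℕ)} {ρ : I → ℝ} (hρpos : ∀ i, 0 < ρ i)
    (hρsum : ∑ i, ρ i = 1) (a : S → ℝ) (i : I) :
    ∃ B, ∀ x ∈ feasX Kbar ρ, xavail Kbar a x i ≤ B :=
  ⟨∑ s, ((if econf i ∈ Kc Kbar s then a s else 0)
      + ∑ _k ∈ (Kc Kbar s).filter (fun k => k + econf i ∈ Kbar s), 1),
    fun _ hx => Finset.sum_le_sum fun _ _ => add_le_add le_rfl <| Finset.sum_le_sum fun _ hk =>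
      feasX_le_one hρpos hρsum hx (Finset.mem_of_mem_filter _ hk)⟩

/-- On the feasible set, `F_k(x) ≥ c x_{k - e_i} - C x_k` whenever `k_i ≥ 1`. -/
theorem exists_le_Fdrift {Kbar : S → Finset (I → ℕ)}
    (hmono : KbarMono Kbar) (hserve : KbarServe Kbar)
    {ρ : I → ℝ} (hρpos : ∀ i, 0 < ρ i) (hρsum : ∑ i, ρ i = 1)
    {a : S → ℝ} (hapos : ∀ s, 0 < a s) {μ : I → ℝ} (hμpos : ∀ i, 0 < μ i)
    {s : S} {k : I → ℕ} (hk : k ∈ Kc Kbar s) {i : I} (hi : 1 ≤ k i) :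
    ∃ c > (0 : ℝ), ∃ C > (0 : ℝ), ∀ x ∈ feasX Kbar ρ,
      c * xval a x s (k - econf i) - C * x s k ≤ Fdrift Kbar a μ ρ x s k := by
  choose A hA hAle using exists_pos_le_xavail hserve hapos
  obtain ⟨B, hB⟩ := exists_xavail_le (Kbar := Kbar) hρpos hρsum a i
  have hk0 : k ≠ 0 := Finset.ne_of_mem_erase hk
  have hlam : ∀ j, 0 < μ j * ρ j := fun j => mul_pos (hμpos j) (hρpos j)
  set M := Finset.univ.filter (fun j : I => 1 ≤ k j ∧ k - econf j ∈ Kbar s)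
  set N := Finset.univ.filter (fun j : I => k + econf j ∈ Kbar s)
  have hC : 0 ≤ ∑ j ∈ M, (k j : ℝ) * μ j + ∑ j ∈ N, μ j * ρ j / A j :=
    add_nonneg (Finset.sum_nonneg fun j _ => mul_nonneg (Nat.cast_nonneg _) (hμpos j).le)
      (Finset.sum_nonneg fun j _ => (div_pos (hlam j) (hA j)).le)
  have hiM : i ∈ M := Finset.mem_filter.2 ⟨Finset.mem_univ i, hi,
    hmono s k (Finset.mem_of_mem_erase hk) _ fun j => Nat.sub_le _ _⟩
  refine ⟨μ i * ρ i / max B 1, div_pos (hlam i) (lt_max_of_lt_right one_pos),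
    ∑ j ∈ M, (k j : ℝ) * μ j + ∑ j ∈ N, μ j * ρ j / A j + 1, by linarith, fun x hx => ?_⟩
  have hnonneg := hx.1.1
  have hxval : ∀ k, 0 ≤ xval a x s k := by
    intro k
    unfold xval
    split_ifs
    exacts [(hapos s).le, hnonneg s k]
  have hav : ∀ j, 0 < xavail Kbar a x j := fun j => (hA j).trans_le (hAle j x hx.1)
  have hin : μ i * ρ i / max B 1 * xval a x s (k - econf i)
      ≤ ∑ j ∈ M, vrate Kbar a μ ρ x s k j := by
    refine le_trans ?_ (Finset.single_le_sum (f := fun j => vrate Kbar a μ ρ x s k j)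
      (fun j _ => div_nonneg (mul_nonneg (hlam j).le (hxval _)) (hav j).le) hiM)
    rw [div_mul_eq_mul_div]
    exact div_le_div_of_nonneg_left (mul_nonneg (hlam i).le (hxval _)) (hav i)
      ((hB x hx).trans (le_max_left _ _))
  have hdep : ∑ j ∈ M, wrate μ x s k j = (∑ j ∈ M, (k j : ℝ) * μ j) * x s k :=
    (Finset.sum_mul _ _ _).symm
  have hout : ∑ j ∈ N, (vrate Kbar a μ ρ x s (k + econf j) j - wrate μ x s (k + econf j) j)
      ≤ (∑ j ∈ N, μ j * ρ j / A j) * x s k := by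
    rw [Finset.sum_mul]
    refine Finset.sum_le_sum fun j _ => (sub_le_self _ ?_).trans ?_
    · exact mul_nonneg (mul_nonneg (Nat.cast_nonneg _) (hμpos j).le) (hnonneg _ _)
    · rw [vrate, add_tsub_cancel_right, xval, if_neg hk0, div_mul_eq_mul_div]
      exact div_le_div_of_nonneg_left (mul_nonneg (hlam j).le (hnonneg _ _)) (hA j) (hAle j x hx.1)
  rw [Fdrift, Finset.sum_sub_distrib, hdep]
  linarith [hnonneg s k]

/-- `x` is a fluid solution on `[0, ∞)` taking values in `X`. -/
def IsFluidSolution (Kbar : S → Finset (I → ℕ)) (a : S → ℝ) (μ ρ : I → ℝ)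
    (x : ℝ → S → (I → ℕ) → ℝ) : Prop :=
  (∀ t : ℝ, 0 ≤ t → x t ∈ feasX Kbar ρ) ∧
    ∀ s, ∀ k ∈ Kc Kbar s, ∀ t : ℝ, 0 ≤ t →
      HasDerivAt (fun τ => x τ s k) (Fdrift Kbar a μ ρ (x t) s k) t

/-- Positivity propagates from `0` along each chain of configurations. -/
theorem exists_pos_le_xval {Kbar : S → Finset (I → ℕ)}
    (hmono : KbarMono Kbar) (hserve : KbarServe Kbar)
    {ρ : I → ℝ} (hρpos : ∀ i, 0 < ρ i) (hρsum : ∑ i, ρ i = 1)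
    {a : S → ℝ} (hapos : ∀ s, 0 < a s) {μ : I → ℝ} (hμpos : ∀ i, 0 < μ i)
    (s : S) (k : I → ℕ) (hk : k ∈ Kbar s) {δ : ℝ} (hδ : 0 < δ) :
    ∃ δ₁ > (0 : ℝ), ∀ x, IsFluidSolution Kbar a μ ρ x →
      ∀ t : ℝ, δ ≤ t → δ₁ ≤ xval a (x t) s k := by
  induction hn : ∑ i, k i generalizing k δ with
  | zero =>
    have hk0 : k = 0 := funext fun i => Finset.sum_eq_zero_iff.1 hn i (Finset.mem_univ i)
    exact ⟨a s, hapos s, fun x _ t _ => by simp [xval, hk0]⟩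
  | succ n ih =>
    have hk0 : k ≠ 0 := by
      rintro rfl
      simp at hn
    obtain ⟨i, hi⟩ := Function.ne_iff.1 hk0
    have hi1 : 1 ≤ k i := Nat.one_le_iff_ne_zero.2 hi
    have hkc : k ∈ Kc Kbar s := Finset.mem_erase.2 ⟨hk0, hk⟩
    have hsum : ∑ j, (k - econf i) j = n := by
      have hle : econf i ≤ k := fun j => by
        rcases eq_or_ne j i with rfl | hj
        · simpa [econf] using hi1
        · simp [econf, hj]
      have hadd : ∑ j, ((k - econf i) j + econf i j) = n + 1 := by
        rw [← hn]
        exact Finset.sum_congr rfl fun j _ => Nat.sub_add_cancel (hle j)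
      have hone : ∑ j, econf i j = 1 := by simp [econf]
      rw [Finset.sum_add_distrib, hone] at hadd
      omega
    obtain ⟨d, hd, hdle⟩ := ih (k - econf i) (hmono s k hk _ fun j => Nat.sub_le _ _)
      (half_pos hδ) hsum
    obtain ⟨c, hc, C, hC, hF⟩ :=
      exists_le_Fdrift hmono hserve hρpos hρsum hapos hμpos hkc hi1
    have hexp : Real.exp (-(C * (δ / 2))) < 1 := by
      rw [← Real.exp_zero]
      exact Real.exp_lt_exp.2 (neg_neg_of_pos (mul_pos hC (half_pos hδ)))
    refine ⟨c * d / C * (1 - Real.exp (-(C * (δ / 2)))),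
      mul_pos (by positivity) (sub_pos.2 hexp), fun x hx t ht => ?_⟩
    have hpos : ∀ u, δ / 2 ≤ u → 0 ≤ u := fun u hu => (half_pos hδ).le.trans hu
    have hcomp := le_of_hasDerivAt_ge_sub_mul (b := c * d) hC
      (fun u hu => hx.2 s k hkc u (hpos u hu))
      (fun u hu => le_trans
        (sub_le_sub_right (mul_le_mul_of_nonneg_left (hdle x hx u hu) hc.le) _)
        (hF (x u) (hx.1 u (hpos u hu))))
      ((hx.1 _ (half_pos hδ).le).1.1 s k) ((half_le_self hδ.le).trans ht)
    rw [xval, if_neg hk0]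
    refine le_trans ?_ hcomp
    have htime : δ / 2 ≤ t - δ / 2 := by linarith
    gcongr

/-- fluid solutions are uniformly bounded away from zero after any time
`δ > 0`, with a constant `δ₁` independent of the particular solution. -/
theorem fluid_solutions_uniformly_positive
    (Kbar : S → Finset (I → ℕ))
    (hmono : KbarMono Kbar) (hzero : KbarZero Kbar) (hserve : KbarServe Kbar)
    (ρ : I → ℝ) (hρpos : ∀ i, 0 < ρ i) (hρsum : ∑ i, ρ i = 1)
    (a : S → ℝ) (hapos : ∀ s, 0 < a s)
    (μ : I → ℝ) (hμpos : ∀ i, 0 < μ i) :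
    ∀ δ > (0 : ℝ), ∃ δ₁ > (0 : ℝ), ∀ x : ℝ → S → (I → ℕ) → ℝ,
      (∀ t : ℝ, 0 ≤ t → x t ∈ feasX Kbar ρ) →
      (∀ s, ∀ k ∈ Kc Kbar s, ∀ t : ℝ, 0 ≤ t →
        HasDerivAt (fun τ => x τ s k) (Fdrift Kbar a μ ρ (x t) s k) t) →
      ∀ t : ℝ, δ ≤ t → ∀ s, ∀ k ∈ Kc Kbar s, δ₁ ≤ x t s k := by
  intro δ hδ
  have hbound : ∀ p ∈ Finset.univ.sigma (Kc Kbar), ∃ d > (0 : ℝ),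
      ∀ x, IsFluidSolution Kbar a μ ρ x → ∀ t : ℝ, δ ≤ t → d ≤ x t p.1 p.2 := by
    rintro ⟨s, k⟩ hp
    have hk : k ∈ Kc Kbar s := (Finset.mem_sigma.1 hp).2
    have h := exists_pos_le_xval hmono hserve hρpos hρsum hapos hμpos s k
      (Finset.mem_of_mem_erase hk) hδ
    simpa only [xval, if_neg (Finset.ne_of_mem_erase hk)] using h
  choose! d hd hdle using hbound
  have hlt_ev : ∀ᶠ ε in 𝓝[>] (0 : ℝ), ∀ p ∈ Finset.univ.sigma (Kc Kbar), ε < d p :=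
    (Filter.eventually_all_finset _).2 fun p hp =>
      eventually_nhdsWithin_of_eventually_nhds (eventually_lt_nhds (hd p hp))
  obtain ⟨δ₁, hlt, hδ₁⟩ := (hlt_ev.and self_mem_nhdsWithin).exists
  exact ⟨δ₁, hδ₁, fun x hX hder t ht s k hk =>
    have hp : (⟨s, k⟩ : Σ _ : S, I → ℕ) ∈ Finset.univ.sigma (Kc Kbar) :=
      Finset.mem_sigma.2 ⟨Finset.mem_univ s, hk⟩
    (hlt _ hp).le.trans (hdle _ hp x ⟨hX, hder⟩ t ht)⟩
end
end
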